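/- Let H be a real Hilbert space and T : H → H a bounded self-adjoint positive linear operator. Suppose v ∈ H is a unit vector with T v = μ v for some μ > 0, and there exists κ with 0 ≤ κ < μ such that ‖T w‖ ≤ κ‖w‖ for every w ∈ H orthogonal to v. If x ∈ H satisfies ⟪v, x⟫ ≠ 0, then the mean square deviation of the iterates tends to zero: writing y_p := T^p x, one has Δ_p := √( ⟪T y_p, T y_p⟫/‖y_p‖² − (⟪y_p, T y_p⟫/‖y_p‖²)² ) → 0 as p → ∞. -/

import Mathlib

open Filter
open scoped RealInnerProductSpace Topology

/-- The mean square deviation of `T` in the state `y / ‖y‖`. -/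
noncomputable def meanSquareDeviation {H : Type*} [NormedAddCommGroup H] [InnerProductSpace ℝ H]
    (T : H →L[ℝ] H) (y : H) : ℝ :=
  Real.sqrt (⟪T y, T y⟫ / ‖y‖ ^ 2 - (⟪y, T y⟫ / ‖y‖ ^ 2) ^ 2)

section

variable {H : Type*} [NormedAddCommGroup H] [InnerProductSpace ℝ H] (T : H →L[ℝ] H)

theorem meanSquareDeviation_smul {a : ℝ} (ha : a ≠ 0) (y : H) :
    meanSquareDeviation T (a • y) = meanSquareDeviation T y := by
  have ha2 : a * a ≠ 0 := mul_ne_zero ha ha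
  have hn : ‖a • y‖ ^ 2 = a * a * ‖y‖ ^ 2 := by
    rw [norm_smul, mul_pow, Real.norm_eq_abs, sq_abs, sq]
  simp only [meanSquareDeviation, hn, map_smul, real_inner_smul_left, real_inner_smul_right,
    ← mul_assoc, mul_div_mul_left _ _ ha2]

theorem continuousAt_meanSquareDeviation {y : H} (hy : y ≠ 0) :
    ContinuousAt (meanSquareDeviation T) y := by
  have hn : ‖y‖ ^ 2 ≠ 0 := pow_ne_zero 2 (norm_ne_zero_iff.mpr hy)
  unfold meanSquareDeviation
  fun_prop (disch := exact hn)

variable {T}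

theorem meanSquareDeviation_eq_zero_of_eigenvector {v : H} (hv : v ≠ 0) {μ : ℝ}
    (hTv : T v = μ • v) : meanSquareDeviation T v = 0 := by
  have hn : ‖v‖ ≠ 0 := norm_ne_zero_iff.mpr hv
  rw [meanSquareDeviation, Real.sqrt_eq_zero']
  apply le_of_eq
  simp only [hTv, real_inner_smul_right, real_inner_self_eq_norm_sq, norm_smul, mul_pow,
    Real.norm_eq_abs, sq_abs]
  field_simp
  ring

theorem pow_apply_eq_smul_of_eigenvector {v : H} {μ : ℝ} (hTv : T v = μ • v) (p : ℕ) :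
    (T ^ p) v = μ ^ p • v := by
  induction p with
  | zero => simp
  | succ p ih => rw [pow_succ', mul_apply_eq_comp, ih, map_smul, hTv, smul_smul,
      pow_succ]

/-- On the orthogonal complement of an eigenvector of a symmetric operator, a norm bound for `T`
passes to its iterates. -/
theorem norm_pow_apply_le_of_inner_eq_zero (hsa : ∀ x y : H, ⟪T x, y⟫ = ⟪x, T y⟫)
    {v : H} {μ : ℝ} (hTv : T v = μ • v) {κ : ℝ} (hκ0 : 0 ≤ κ)
    (hgap : ∀ w : H, ⟪v, w⟫ = 0 → ‖T w‖ ≤ κ * ‖w‖) {w : H} (hw : ⟪v, w⟫ = 0) (p : ℕ) :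
    ‖(T ^ p) w‖ ≤ κ ^ p * ‖w‖ := by
  have horth (p : ℕ) : ⟪v, (T ^ p) w⟫ = 0 := by
    induction p with
    | zero => simpa using hw
    | succ p ih => rw [pow_succ', mul_apply_eq_comp, ← hsa, hTv,
        real_inner_smul_left, ih, mul_zero]
  induction p with
  | zero => simp
  | succ p ih =>
    rw [pow_succ', mul_apply_eq_comp, pow_succ', mul_assoc]
    exact (hgap _ (horth p)).trans (mul_le_mul_of_nonneg_left ih hκ0)

/-- Convergence of the power method: the rescaled iterates tend to the component of the
starting vector along the dominant eigenvector. -/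
theorem tendsto_inv_pow_smul_pow_apply (hsa : ∀ x y : H, ⟪T x, y⟫ = ⟪x, T y⟫)
    {v : H} (hv : ‖v‖ = 1) {μ : ℝ} (hμ : 0 < μ) (hTv : T v = μ • v)
    {κ : ℝ} (hκ0 : 0 ≤ κ) (hκμ : κ < μ)
    (hgap : ∀ w : H, ⟪v, w⟫ = 0 → ‖T w‖ ≤ κ * ‖w‖) (x : H) :
    Tendsto (fun p : ℕ => (μ ^ p)⁻¹ • (T ^ p) x) atTop (𝓝 (⟪v, x⟫ • v)) := by
  have hw : ⟪v, x - ⟪v, x⟫ • v⟫ = 0 := by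
    simp [inner_sub_right, real_inner_smul_right, hv]
  have hlim : Tendsto (fun p : ℕ => (κ / μ) ^ p * ‖x - ⟪v, x⟫ • v‖) atTop (𝓝 0) := by
    simpa using (tendsto_pow_atTop_nhds_zero_of_lt_one (div_nonneg hκ0 hμ.le)
      ((div_lt_one hμ).mpr hκμ)).mul_const ‖x - ⟪v, x⟫ • v‖
  rw [tendsto_iff_norm_sub_tendsto_zero]
  refine squeeze_zero (fun _ => norm_nonneg _) (fun p => ?_) hlim
  have hμp : 0 < μ ^ p := pow_pos hμ p
  have hdecomp : (μ ^ p)⁻¹ • (T ^ p) x - ⟪v, x⟫ • v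
      = (μ ^ p)⁻¹ • (T ^ p) (x - ⟪v, x⟫ • v) := by
    rw [map_sub, map_smul, pow_apply_eq_smul_of_eigenvector hTv, smul_sub,
      smul_comm ⟪v, x⟫ (μ ^ p) v, inv_smul_smul₀ hμp.ne']
  rw [hdecomp, norm_smul, norm_inv, Real.norm_of_nonneg hμp.le, div_pow, div_eq_inv_mul, mul_assoc]
  exact mul_le_mul_of_nonneg_left
    (norm_pow_apply_le_of_inner_eq_zero hsa hTv hκ0 hgap hw p) (inv_nonneg.mpr hμp.le)

end

/-- The mean square deviation (variance of `T` in the state of the normalized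
power-method iterate) tends to zero for a bounded self-adjoint positive operator
with a spectral gap, when the ansatz has nonzero overlap with the top
eigenvector. -/
theorem mean_square_deviation_of_iterates_tendsto_zero
    {H : Type*} [NormedAddCommGroup H] [InnerProductSpace ℝ H] [CompleteSpace H]
    (T : H →L[ℝ] H)
    (hsa : ∀ x y : H, ⟪T x, y⟫ = ⟪x, T y⟫)
    (hpos : ∀ x : H, 0 ≤ ⟪x, T x⟫)
    (v : H) (hv : ‖v‖ = 1) (μ : ℝ) (hμ : 0 < μ) (hTv : T v = μ • v)
    (κ : ℝ) (hκ0 : 0 ≤ κ) (hκμ : κ < μ)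
    (hgap : ∀ w : H, ⟪v, w⟫ = 0 → ‖T w‖ ≤ κ * ‖w‖)
    (x : H) (hx : ⟪v, x⟫ ≠ 0) :
    Tendsto (fun p : ℕ =>
        Real.sqrt (⟪T ((T ^ p) x), T ((T ^ p) x)⟫ / ‖(T ^ p) x‖ ^ 2 -
          (⟪(T ^ p) x, T ((T ^ p) x)⟫ / ‖(T ^ p) x‖ ^ 2) ^ 2))
      atTop (𝓝 0) := by
  have hlim : ⟪v, x⟫ • v ≠ 0 := smul_ne_zero hx (norm_ne_zero_iff.mp (hv ▸ one_ne_zero))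
  have hT : T (⟪v, x⟫ • v) = μ • ⟪v, x⟫ • v := by rw [map_smul, hTv, smul_comm]
  have h := (continuousAt_meanSquareDeviation T hlim).tendsto.comp
    (tendsto_inv_pow_smul_pow_apply hsa hv hμ hTv hκ0 hκμ hgap x)
  rw [meanSquareDeviation_eq_zero_of_eigenvector hlim hT] at h
  exact h.congr fun p => meanSquareDeviation_smul T (inv_ne_zero (pow_ne_zero p hμ.ne')) _
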